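/- arXiv:2302.11808 — 2 statements merged into one kernel-verified Lean document; each statement's English description precedes it below -/
import Mathlib

section
/- Let k be a natural number. (E) If φ ∈ Σ_{k+1}^+, ψ ∈ Π_{k+1}^+, and k+1 = max{deg(φ), deg(ψ)}, then there exists π ∈ Π_{k+1} such that (φ → ψ) ⊳* π. (F) If φ ∈ Π_{k+1}^+, ψ ∈ Σ_{k+1}^+, and k+1 = max{deg(φ), deg(ψ)}, then there exists σ ∈ Σ_{k+1} such that (φ → ψ) ⊳* σ. (G) If φ, ψ ∈ Σ_{k+1}, then there exist σ ∈ Σ_{k+2} and π ∈ Π_{k+2} such that (φ → ψ) ⊳* σ and (φ → ψ) ⊳* π. (H) If φ, ψ ∈ Π_{k+1}, then there exist σ ∈ Σ_{k+2} and π ∈ Π_{k+2} such that (φ → ψ) ⊳* σ and (φ → ψ) ⊳* π. -/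
namespace PrenexPaper

/-- A first-order language: function symbols and relation symbols with arities. -/
structure Lang where
  Func : Type
  farity : Func → ℕ
  Rel : Type
  rarity : Rel → ℕ

/-- First-order terms over a language `L` with variables from `V`. -/
inductive Term (L : Lang) (V : Type) : Type
  | var : V → Term L V
  | func : (f : L.Func) → (Fin (L.farity f) → Term L V) → Term L V

/-- First-order formulas built from atomic formulas (including ⊥) by ∧, ∨, →, ∀x, ∃x. -/
inductive Fml (L : Lang) (V : Type) : Type
  | falsum : Fml L V
  | rel : (r : L.Rel) → (Fin (L.rarity r) → Term L V) → Fml L V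
  | and : Fml L V → Fml L V → Fml L V
  | or : Fml L V → Fml L V → Fml L V
  | imp : Fml L V → Fml L V → Fml L V
  | all : V → Fml L V → Fml L V
  | ex : V → Fml L V → Fml L V

variable {L : Lang} {V : Type}

/-- Variables occurring in a term. -/
def Term.vars : Term L V → Set V
  | .var x => {x}
  | .func _ ts => ⋃ i, (ts i).vars

/-- Free variables of a formula. -/
def Fml.fv : Fml L V → Set V
  | .falsum => ∅
  | .rel _ ts => ⋃ i, (ts i).vars
  | .and φ ψ => φ.fv ∪ ψ.fv
  | .or φ ψ => φ.fv ∪ ψ.fv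
  | .imp φ ψ => φ.fv ∪ ψ.fv
  | .all x φ => φ.fv \ {x}
  | .ex x φ => φ.fv \ {x}

/-- All variables appearing in a formula (free or bound). -/
def Fml.vars : Fml L V → Set V
  | .falsum => ∅
  | .rel _ ts => ⋃ i, (ts i).vars
  | .and φ ψ => φ.vars ∪ ψ.vars
  | .or φ ψ => φ.vars ∪ ψ.vars
  | .imp φ ψ => φ.vars ∪ ψ.vars
  | .all x φ => insert x φ.vars
  | .ex x φ => insert x φ.vars

/-- Number of quantifier occurrences. -/
def Fml.numQ : Fml L V → ℕ
  | .falsum => 0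
  | .rel _ _ => 0
  | .and φ ψ => φ.numQ + ψ.numQ
  | .or φ ψ => φ.numQ + ψ.numQ
  | .imp φ ψ => φ.numQ + ψ.numQ
  | .all _ φ => φ.numQ + 1
  | .ex _ φ => φ.numQ + 1

/-- Number of occurrences of the binary connectives ∧, ∨, →. -/
def Fml.numConn : Fml L V → ℕ
  | .falsum => 0
  | .rel _ _ => 0
  | .and φ ψ => φ.numConn + ψ.numConn + 1
  | .or φ ψ => φ.numConn + ψ.numConn + 1
  | .imp φ ψ => φ.numConn + ψ.numConn + 1
  | .all _ φ => φ.numConn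
  | .ex _ φ => φ.numConn

/-- Quantifier-free formulas. -/
def Fml.qf : Fml L V → Prop
  | .falsum => True
  | .rel _ _ => True
  | .and φ ψ => φ.qf ∧ ψ.qf
  | .or φ ψ => φ.qf ∧ ψ.qf
  | .imp φ ψ => φ.qf ∧ ψ.qf
  | .all _ _ => False
  | .ex _ _ => False

/-! ### Alternation paths and the classes E, U, F, PF

An alternation path is represented as a `List Bool`, where `true` stands for `+`
and `false` stands for `−` (alternation is automatic from the construction below). -/

/-- `s^⊥`: switch + and − in an alternation path. -/
def negPath (s : List Bool) : List Bool := s.map (fun b => !b)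

/-- The set `Alt(φ)` of alternation paths of a formula.  The first symbol `i(s)` of a
path `s` is `s.head?` (`none` corresponding to `×` for the empty path). -/
def Fml.alt : Fml L V → Set (List Bool)
  | .falsum => {[]}
  | .rel _ _ => {[]}
  | .and φ ψ => φ.alt ∪ ψ.alt
  | .or φ ψ => φ.alt ∪ ψ.alt
  | .imp φ ψ => (negPath '' φ.alt) ∪ ψ.alt
  | .all _ φ => {s ∈ φ.alt | s.head? = some false} ∪
      (fun s => false :: s) '' {s ∈ φ.alt | s.head? ≠ some false}
  | .ex _ φ => {s ∈ φ.alt | s.head? = some true} ∪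
      (fun s => true :: s) '' {s ∈ φ.alt | s.head? ≠ some true}

/-- The degree `deg(φ) = max { l(s) | s ∈ Alt(φ) }`. -/
noncomputable def Fml.deg (φ : Fml L V) : ℕ := sSup (List.length '' φ.alt)

/-- The class `F_k` of formulas of degree exactly `k`. -/
def Fc (k : ℕ) : Set (Fml L V) := {φ | φ.deg = k}

/-- The cumulative class `F_k^+` of formulas of degree at most `k`. -/
def FcP (k : ℕ) : Set (Fml L V) := {φ | φ.deg ≤ k}

/-- The class `U_k`. -/
def Uc : ℕ → Set (Fml L V)
  | 0 => Fc 0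
  | (k+1) => {φ | φ ∈ Fc (k+1) ∧ ∀ s ∈ φ.alt, s.length = k+1 → s.head? = some false}

/-- The class `E_k`. -/
def Ec : ℕ → Set (Fml L V)
  | 0 => Fc 0
  | (k+1) => {φ | φ ∈ Fc (k+1) ∧ ∀ s ∈ φ.alt, s.length = k+1 → s.head? = some true}

/-- The class `PF_k = F_k \ (E_k ∪ U_k)`. -/
def PFc (k : ℕ) : Set (Fml L V) := Fc k \ (Ec k ∪ Uc k)

/-- The cumulative class `U_k^+ = U_k ∪ ⋃_{i<k} F_i`. -/
def UcP (k : ℕ) : Set (Fml L V) := Uc k ∪ ⋃ i < k, Fc i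

/-- The cumulative class `E_k^+ = E_k ∪ ⋃_{i<k} F_i`. -/
def EcP (k : ℕ) : Set (Fml L V) := Ec k ∪ ⋃ i < k, Fc i

/-! ### The prenex classes Σ_k and Π_k -/

/-- Formulas `∃x₁⋯∃xₙ φ` with `n ≥ 1` and `φ ∈ S`. -/
inductive ExBlock (S : Set (Fml L V)) : Fml L V → Prop
  | one {x : V} {φ : Fml L V} : φ ∈ S → ExBlock S (.ex x φ)
  | more {x : V} {φ : Fml L V} : ExBlock S φ → ExBlock S (.ex x φ)

/-- Formulas `∀x₁⋯∀xₙ φ` with `n ≥ 1` and `φ ∈ S`. -/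
inductive AllBlock (S : Set (Fml L V)) : Fml L V → Prop
  | one {x : V} {φ : Fml L V} : φ ∈ S → AllBlock S (.all x φ)
  | more {x : V} {φ : Fml L V} : AllBlock S φ → AllBlock S (.all x φ)

/-- The pair `(Σ_k, Π_k)`. -/
def SP : ℕ → Set (Fml L V) × Set (Fml L V)
  | 0 => ({φ | φ.qf}, {φ | φ.qf})
  | (k+1) => ({φ | ExBlock (SP k).2 φ}, {φ | AllBlock (SP k).1 φ})

/-- The class `Σ_k`. -/
def SigmaC (k : ℕ) : Set (Fml L V) := (SP k).1

/-- The class `Π_k`. -/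
def PiC (k : ℕ) : Set (Fml L V) := (SP k).2

/-- The cumulative class `Σ_k^+ = Σ_k ∪ ⋃_{i<k} (Σ_i ∪ Π_i)`. -/
def SigmaP (k : ℕ) : Set (Fml L V) := SigmaC k ∪ ⋃ i < k, (SigmaC i ∪ PiC i)

/-- The cumulative class `Π_k^+ = Π_k ∪ ⋃_{i<k} (Σ_i ∪ Π_i)`. -/
def PiP (k : ℕ) : Set (Fml L V) := PiC k ∪ ⋃ i < k, (SigmaC i ∪ PiC i)

/-- A formula is in prenex normal form if it is in `Σ_k ∪ Π_k` for some `k`. -/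
def Prenex (φ : Fml L V) : Prop := ∃ k, φ ∈ SigmaC k ∪ PiC k

/-! ### Prenex transformations -/

variable [DecidableEq V]

/-- Replace the variable `x` by `y` in a term. -/
def Term.rename (x y : V) : Term L V → Term L V
  | .var z => if z = x then .var y else .var z
  | .func f ts => .func f (fun i => (ts i).rename x y)

/-- Replace the free occurrences of the variable `x` by `y` in a formula. -/
def Fml.rename (x y : V) : Fml L V → Fml L V
  | .falsum => .falsum
  | .rel r ts => .rel r (fun i => (ts i).rename x y)
  | .and φ ψ => .and (φ.rename x y) (ψ.rename x y)
  | .or φ ψ => .or (φ.rename x y) (ψ.rename x y)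
  | .imp φ ψ => .imp (φ.rename x y) (ψ.rename x y)
  | .all z φ => if z = x then .all z φ else .all z (φ.rename x y)
  | .ex z φ => if z = x then .ex z φ else .ex z (φ.rename x y)

/-- `φ ⊳ ψ` : `ψ` is a prenex transformation of `φ` (the eight rows of the table,
rows 3–8 for both quantifiers). -/
inductive Step : Fml L V → Fml L V → Prop
  | r1 (x : V) (ξ δ : Fml L V) (h : x ∉ δ.fv) :
      Step (.imp (.ex x ξ) δ) (.all x (.imp ξ δ))
  | r2 (x : V) (ξ δ : Fml L V) (h : x ∉ δ.fv) :
      Step (.imp (.all x ξ) δ) (.ex x (.imp ξ δ))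
  | r3all (x : V) (ξ δ : Fml L V) (h : x ∉ δ.fv) :
      Step (.imp δ (.all x ξ)) (.all x (.imp δ ξ))
  | r3ex (x : V) (ξ δ : Fml L V) (h : x ∉ δ.fv) :
      Step (.imp δ (.ex x ξ)) (.ex x (.imp δ ξ))
  | r4all (x : V) (ξ δ : Fml L V) (h : x ∉ δ.fv) :
      Step (.and (.all x ξ) δ) (.all x (.and ξ δ))
  | r4ex (x : V) (ξ δ : Fml L V) (h : x ∉ δ.fv) :
      Step (.and (.ex x ξ) δ) (.ex x (.and ξ δ))
  | r5all (x : V) (ξ δ : Fml L V) (h : x ∉ δ.fv) :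
      Step (.and δ (.all x ξ)) (.all x (.and δ ξ))
  | r5ex (x : V) (ξ δ : Fml L V) (h : x ∉ δ.fv) :
      Step (.and δ (.ex x ξ)) (.ex x (.and δ ξ))
  | r6all (x : V) (ξ δ : Fml L V) (h : x ∉ δ.fv) :
      Step (.or (.all x ξ) δ) (.all x (.or ξ δ))
  | r6ex (x : V) (ξ δ : Fml L V) (h : x ∉ δ.fv) :
      Step (.or (.ex x ξ) δ) (.ex x (.or ξ δ))
  | r7all (x : V) (ξ δ : Fml L V) (h : x ∉ δ.fv) :
      Step (.or δ (.all x ξ)) (.all x (.or δ ξ))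
  | r7ex (x : V) (ξ δ : Fml L V) (h : x ∉ δ.fv) :
      Step (.or δ (.ex x ξ)) (.ex x (.or δ ξ))
  | r8all (x y : V) (ξ : Fml L V) (h : y ∉ ξ.vars) :
      Step (.all x ξ) (.all y (ξ.rename x y))
  | r8ex (x y : V) (ξ : Fml L V) (h : y ∉ ξ.vars) :
      Step (.ex x ξ) (.ex y (ξ.rename x y))

/-- `Repl R φ ψ` : `ψ` is obtained from `φ` by replacing one occurrence of a
subformula `ξ` of `φ` with a formula `δ` such that `R ξ δ`. -/
inductive Repl (R : Fml L V → Fml L V → Prop) : Fml L V → Fml L V → Prop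
  | base {φ ψ : Fml L V} : R φ ψ → Repl R φ ψ
  | andL {φ φ' ψ : Fml L V} : Repl R φ φ' → Repl R (.and φ ψ) (.and φ' ψ)
  | andR {φ ψ ψ' : Fml L V} : Repl R ψ ψ' → Repl R (.and φ ψ) (.and φ ψ')
  | orL {φ φ' ψ : Fml L V} : Repl R φ φ' → Repl R (.or φ ψ) (.or φ' ψ)
  | orR {φ ψ ψ' : Fml L V} : Repl R ψ ψ' → Repl R (.or φ ψ) (.or φ ψ')
  | impL {φ φ' ψ : Fml L V} : Repl R φ φ' → Repl R (.imp φ ψ) (.imp φ' ψ)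
  | impR {φ ψ ψ' : Fml L V} : Repl R ψ ψ' → Repl R (.imp φ ψ) (.imp φ ψ')
  | allC {x : V} {φ φ' : Fml L V} : Repl R φ φ' → Repl R (.all x φ) (.all x φ')
  | exC {x : V} {φ φ' : Fml L V} : Repl R φ φ' → Repl R (.ex x φ) (.ex x φ')

/-- `φ ⊳* ψ` : `ψ` is obtained from `φ` by finitely many prenex transformations,
each applied to one occurrence of a subformula. -/
def DTA : Fml L V → Fml L V → Prop := Relation.ReflTransGen (Repl Step)

/-- `PNF(φ)` : the set of prenex normal forms reachable from `φ`. -/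
def PNF (φ : Fml L V) : Set (Fml L V) := {ψ | DTA φ ψ ∧ Prenex ψ}

/-! ### Tarskian semantics -/

/-- A structure for the language `L` with domain `M`. -/
structure Struc (L : Lang) (M : Type) where
  funcI : (f : L.Func) → (Fin (L.farity f) → M) → M
  relI : (r : L.Rel) → (Fin (L.rarity r) → M) → Prop

/-- Evaluation of a term in a structure under a variable assignment. -/
def Term.eval {M : Type} (S : Struc L M) (v : V → M) : Term L V → M
  | .var x => v x
  | .func f ts => S.funcI f (fun i => (ts i).eval S v)

/-- Tarskian satisfaction of a formula in a structure under a variable assignment. -/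
def Sat {M : Type} (S : Struc L M) (v : V → M) : Fml L V → Prop
  | .falsum => False
  | .rel r ts => S.relI r (fun i => (ts i).eval S v)
  | .and φ ψ => Sat S v φ ∧ Sat S v ψ
  | .or φ ψ => Sat S v φ ∨ Sat S v ψ
  | .imp φ ψ => Sat S v φ → Sat S v ψ
  | .all x φ => ∀ m : M, Sat S (Function.update v x m) φ
  | .ex x φ => ∃ m : M, Sat S (Function.update v x m) φ

/-! ### Auxiliary material for the proof -/

/-- Uniform quantifier: `true` is ∃ and `false` is ∀. -/
def Fml.Q : Bool → V → Fml L V → Fml L V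
  | true, x, φ => .ex x φ
  | false, x, φ => .all x φ

/-- `n` quantifiers of kind `b` in front of a formula in `S`. -/
def BlkN (b : Bool) (S : Set (Fml L V)) : ℕ → Set (Fml L V)
  | 0 => S
  | n+1 => {φ | ∃ x, ∃ φ' ∈ BlkN b S n, φ = Fml.Q b x φ'}

/-- Uniform version of `Σ_k` (`true`) and `Π_k` (`false`). -/
def Cls : Bool → ℕ → Set (Fml L V)
  | _, 0 => {φ | φ.qf}
  | b, k+1 => {φ | ∃ n, φ ∈ BlkN b (Cls (!b) k) (n+1)}

/-- Uniform version of the cumulative classes. -/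
def Plus (b : Bool) (k : ℕ) : Set (Fml L V) :=
  {φ | φ ∈ Cls b k ∨ ∃ i, i < k ∧ ∃ c, φ ∈ Cls c i}

theorem exBlock_iff (S : Set (Fml L V)) (φ : Fml L V) :
    ExBlock S φ ↔ ∃ n, φ ∈ BlkN true S (n+1) := by
  constructor
  · intro h
    induction h with
    | one h => exact ⟨0, _, _, h, rfl⟩
    | more _ ih => obtain ⟨n, hn⟩ := ih; exact ⟨n+1, _, _, hn, rfl⟩
  · rintro ⟨n, hn⟩
    induction n generalizing φ with
    | zero => obtain ⟨x, φ', h, rfl⟩ := hn; exact .one h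
    | succ n ih => obtain ⟨x, φ', h, rfl⟩ := hn; exact .more (ih _ h)

theorem allBlock_iff (S : Set (Fml L V)) (φ : Fml L V) :
    AllBlock S φ ↔ ∃ n, φ ∈ BlkN false S (n+1) := by
  constructor
  · intro h
    induction h with
    | one h => exact ⟨0, _, _, h, rfl⟩
    | more _ ih => obtain ⟨n, hn⟩ := ih; exact ⟨n+1, _, _, hn, rfl⟩
  · rintro ⟨n, hn⟩
    induction n generalizing φ with
    | zero => obtain ⟨x, φ', h, rfl⟩ := hn; exact .one h
    | succ n ih => obtain ⟨x, φ', h, rfl⟩ := hn; exact .more (ih _ h)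

theorem SP_eq (k : ℕ) : (SP k : Set (Fml L V) × Set (Fml L V)) = (Cls true k, Cls false k) := by
  induction k with
  | zero => rfl
  | succ k ih =>
    simp only [SP, ih, exBlock_iff, allBlock_iff]
    rfl

theorem sigmaC_eq (k : ℕ) : (SigmaC k : Set (Fml L V)) = Cls true k := by
  simp [SigmaC, SP_eq]

theorem piC_eq (k : ℕ) : (PiC k : Set (Fml L V)) = Cls false k := by
  simp [PiC, SP_eq]

theorem sigmaP_eq (k : ℕ) : (SigmaP k : Set (Fml L V)) = Plus true k := by
  ext φ
  simp [SigmaP, Plus, sigmaC_eq, piC_eq, or_comm]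

theorem piP_eq (k : ℕ) : (PiP k : Set (Fml L V)) = Plus false k := by
  ext φ
  simp [PiP, Plus, sigmaC_eq, piC_eq, or_comm]

/-! Degrees -/

theorem alt_qf (φ : Fml L V) (h : φ.qf) : ∀ s ∈ φ.alt, s = [] := by
  induction φ with
  | falsum => simp [Fml.alt]
  | rel r ts => simp [Fml.alt]
  | and φ ψ h1 h2 =>
    rintro s (hs | hs)
    · exact h1 h.1 s hs
    · exact h2 h.2 s hs
  | or φ ψ h1 h2 =>
    rintro s (hs | hs)
    · exact h1 h.1 s hs
    · exact h2 h.2 s hs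
  | imp φ ψ h1 h2 =>
    rintro s (⟨t, hs, rfl⟩ | hs)
    · rw [h1 h.1 t hs]; rfl
    · exact h2 h.2 s hs
  | all x φ _ => exact h.elim
  | ex x φ _ => exact h.elim

theorem alt_Q (b : Bool) (x : V) (φ : Fml L V) (s : List Bool) (hs : s ∈ (Fml.Q b x φ).alt) :
    (s ∈ φ.alt ∧ s.head? = some b) ∨ ∃ t ∈ φ.alt, t.head? ≠ some b ∧ s = b :: t := by
  cases b
  · rcases hs with hs | ⟨t, ht, rfl⟩
    · exact .inl hs
    · exact .inr ⟨t, ht.1, ht.2, rfl⟩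
  · rcases hs with hs | ⟨t, ht, rfl⟩
    · exact .inl hs
    · exact .inr ⟨t, ht.1, ht.2, rfl⟩

theorem alt_cls (k : ℕ) (b : Bool) (φ : Fml L V) (h : φ ∈ Cls b k) :
    ∀ s ∈ φ.alt, s.length ≤ k ∧ (k ≠ 0 → s.head? = some b) := by
  induction k generalizing b φ with
  | zero => intro s hs; simp [alt_qf φ h s hs]
  | succ k ih =>
    obtain ⟨n, hn⟩ := h
    induction n generalizing φ with
    | zero =>
      obtain ⟨x, φ', h', rfl⟩ := hn
      intro s hs
      rcases alt_Q b x φ' s hs with ⟨h1, h2⟩ | ⟨t, h1, h2, rfl⟩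
      · have := ih _ _ h' s h1
        exact ⟨by omega, fun _ => h2⟩
      · have := ih _ _ h' t h1
        exact ⟨by simpa using this.1, fun _ => rfl⟩
    | succ n ihn =>
      obtain ⟨x, φ', h', rfl⟩ := hn
      intro s hs
      rcases alt_Q b x φ' s hs with ⟨h1, h2⟩ | ⟨t, h1, h2, rfl⟩
      · exact ihn _ h' s h1
      · exact absurd ((ihn _ h' t h1).2 (by omega)) h2

theorem deg_cls (k : ℕ) (b : Bool) (φ : Fml L V) (h : φ ∈ Cls b k) : φ.deg ≤ k := by
  apply csSup_le'
  rintro _ ⟨s, hs, rfl⟩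
  exact (alt_cls k b φ h s hs).1

theorem cls_of_deg (k : ℕ) (b : Bool) (φ : Fml L V) (h : φ ∈ Plus b k) (hd : k ≤ φ.deg) :
    φ ∈ Cls b k := by
  rcases h with h | ⟨i, hi, c, h⟩
  · exact h
  · have := deg_cls _ _ _ h
    omega

theorem plus_succ (k : ℕ) (b : Bool) (φ : Fml L V) (h : φ ∈ Plus b (k+1)) :
    ∃ n, φ ∈ BlkN b (Plus (!b) k) n := by
  have mono : ∀ (S T : Set (Fml L V)), S ⊆ T → ∀ n, BlkN b S n ⊆ BlkN b T n := by
    intro S T hST n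
    induction n with
    | zero => exact hST
    | succ n ih => rintro φ ⟨x, φ', h, rfl⟩; exact ⟨x, φ', ih h, rfl⟩
  rcases h with ⟨n, hn⟩ | ⟨i, hi, c, h⟩
  · exact ⟨n+1, mono _ _ (fun _ h => Or.inl h) _ hn⟩
  · by_cases hik : i < k
    · exact ⟨0, .inr ⟨i, hik, c, h⟩⟩
    · obtain rfl : i = k := by omega
      by_cases hc : c = !b
      · subst hc; exact ⟨0, .inl h⟩
      · obtain rfl : c = b := by cases b <;> cases c <;> simp_all
        cases i with
        | zero => exact ⟨0, .inl h⟩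
        | succ i =>
          obtain ⟨n, hn⟩ := h
          exact ⟨n+1, mono _ _ (fun _ h => Or.inr ⟨i, by omega, _, h⟩) _ hn⟩

/-! Renaming -/

/-- Closure under renaming. -/
def RC (S : Set (Fml L V)) : Prop := ∀ φ ∈ S, ∀ x y : V, φ.rename x y ∈ S

theorem rename_Q (b : Bool) (x y z : V) (φ : Fml L V) :
    (Fml.Q b z φ).rename x y = if z = x then Fml.Q b z φ else Fml.Q b z (φ.rename x y) := by
  cases b <;> rfl

theorem rc_blkN (b : Bool) (S : Set (Fml L V)) (hS : RC S) (n : ℕ) : RC (BlkN b S n) := by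
  induction n with
  | zero => exact hS
  | succ n ih =>
    rintro _ ⟨z, φ', h, rfl⟩ x y
    rw [rename_Q]
    split_ifs
    · exact ⟨z, φ', h, rfl⟩
    · exact ⟨z, _, ih _ h x y, rfl⟩

theorem qf_rename (φ : Fml L V) (x y : V) (h : φ.qf) : (φ.rename x y).qf := by
  induction φ with
  | falsum => trivial
  | rel r ts => trivial
  | and φ ψ h1 h2 => exact ⟨h1 h.1, h2 h.2⟩
  | or φ ψ h1 h2 => exact ⟨h1 h.1, h2 h.2⟩
  | imp φ ψ h1 h2 => exact ⟨h1 h.1, h2 h.2⟩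
  | all x φ _ => exact h.elim
  | ex x φ _ => exact h.elim

theorem rc_cls (b : Bool) (k : ℕ) : RC (Cls b k : Set (Fml L V)) := by
  induction k generalizing b with
  | zero => intro φ h x y; exact qf_rename φ x y h
  | succ k ih => rintro φ ⟨n, h⟩ x y; exact ⟨n, rc_blkN b _ (ih _) _ φ h x y⟩

theorem rc_plus (b : Bool) (k : ℕ) : RC (Plus b k : Set (Fml L V)) := by
  rintro φ (h | ⟨i, hi, c, h⟩) x y
  · exact .inl (rc_cls _ _ _ h x y)
  · exact .inr ⟨i, hi, c, rc_cls _ _ _ h x y⟩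

/-! Fresh variables -/

theorem term_vars_finite (t : Term L V) : t.vars.Finite := by
  induction t with
  | var x => exact Set.finite_singleton x
  | func f ts ih => exact Set.finite_iUnion ih

theorem vars_finite (φ : Fml L V) : φ.vars.Finite := by
  induction φ with
  | falsum => exact Set.finite_empty
  | rel r ts => exact Set.finite_iUnion fun i => term_vars_finite _
  | and φ ψ h1 h2 => exact h1.union h2
  | or φ ψ h1 h2 => exact h1.union h2
  | imp φ ψ h1 h2 => exact h1.union h2
  | all x φ h => exact h.insert x
  | ex x φ h => exact h.insert x

theorem fv_subset (φ : Fml L V) : φ.fv ⊆ φ.vars := by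
  induction φ with
  | falsum => exact subset_rfl
  | rel r ts => exact subset_rfl
  | and φ ψ h1 h2 => exact Set.union_subset_union h1 h2
  | or φ ψ h1 h2 => exact Set.union_subset_union h1 h2
  | imp φ ψ h1 h2 => exact Set.union_subset_union h1 h2
  | all x φ h => exact fun z hz => .inr (h hz.1)
  | ex x φ h => exact fun z hz => .inr (h hz.1)

theorem exists_fresh [Infinite V] (φ ψ : Fml L V) : ∃ y, y ∉ φ.vars ∧ y ∉ ψ.fv := by
  obtain ⟨y, hy⟩ := ((vars_finite φ).union (vars_finite ψ)).exists_notMem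
  exact ⟨y, fun h => hy (.inl h), fun h => hy (.inr (fv_subset _ h))⟩

/-! Pulling quantifiers -/

theorem DTA.Q (b : Bool) (x : V) {φ ψ : Fml L V} (h : DTA φ ψ) :
    DTA (Fml.Q b x φ) (Fml.Q b x ψ) := by
  induction h with
  | refl => exact .refl
  | tail _ hac ih =>
    refine Relation.ReflTransGen.tail ih ?_
    cases b
    · exact .allC hac
    · exact .exC hac

theorem pullL [Infinite V] (b : Bool) (x : V) (φ ψ : Fml L V) :
    ∃ y, DTA (.imp (Fml.Q b x φ) ψ) (Fml.Q (!b) y (.imp (φ.rename x y) ψ)) := by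
  obtain ⟨y, h1, h2⟩ := exists_fresh φ ψ
  refine ⟨y, ?_⟩
  cases b
  · exact .tail (.single (.impL (.base (.r8all x y φ h1)))) (.base (.r2 y _ _ h2))
  · exact .tail (.single (.impL (.base (.r8ex x y φ h1)))) (.base (.r1 y _ _ h2))

theorem pullR [Infinite V] (b : Bool) (x : V) (φ ψ : Fml L V) :
    ∃ y, DTA (.imp φ (Fml.Q b x ψ)) (Fml.Q b y (.imp φ (ψ.rename x y))) := by
  obtain ⟨y, h1, h2⟩ := exists_fresh ψ φ
  refine ⟨y, ?_⟩
  cases b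
  · exact .tail (.single (.impR (.base (.r8all x y ψ h1)))) (.base (.r3all y _ _ h2))
  · exact .tail (.single (.impR (.base (.r8ex x y ψ h1)))) (.base (.r3ex y _ _ h2))

theorem pull [Infinite V] (b c : Bool) (hc : c = !b) (S T R : Set (Fml L V)) (hS : RC S) (hT : RC T)
    (H : ∀ φ ∈ S, ∀ ψ ∈ T, ∃ χ ∈ R, DTA (.imp φ ψ) χ) (n m : ℕ) :
    ∀ φ ∈ BlkN b S n, ∀ ψ ∈ BlkN c T m, ∃ χ ∈ BlkN c R (n+m), DTA (.imp φ ψ) χ := by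
  induction n with
  | zero =>
    rw [Nat.zero_add]
    induction m with
    | zero => exact H
    | succ m ih =>
      rintro φ hφ _ ⟨x, ψ', h', rfl⟩
      obtain ⟨y, hy⟩ := pullR c x φ ψ'
      obtain ⟨χ, hχ, hd⟩ := ih φ hφ _ (rc_blkN _ _ hT _ _ h' x y)
      exact ⟨_, ⟨y, χ, hχ, rfl⟩, Relation.ReflTransGen.trans hy (hd.Q c y)⟩
  | succ n ih =>
    rintro _ ⟨x, φ', h', rfl⟩ ψ hψ
    obtain ⟨y, hy⟩ := pullL b x φ' ψ
    obtain ⟨χ, hχ, hd⟩ := ih _ (rc_blkN _ _ hS _ _ h' x y) ψ hψ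
    rw [Nat.add_right_comm]
    rw [← hc] at hy
    exact ⟨_, ⟨y, χ, hχ, rfl⟩, Relation.ReflTransGen.trans hy (hd.Q c y)⟩

theorem main_EF [Infinite V] (k : ℕ) : ∀ (b c : Bool), c = !b → ∀ φ ψ : Fml L V,
    φ ∈ Plus b k → ψ ∈ Plus c k → (φ ∈ Cls b k ∨ ψ ∈ Cls c k) →
    ∃ χ ∈ Cls c k, DTA (.imp φ ψ) χ := by
  induction k with
  | zero =>
    rintro b c hc φ ψ (h1 | ⟨i, hi, _⟩) (h2 | ⟨j, hj, _⟩) _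
    · exact ⟨.imp φ ψ, ⟨h1, h2⟩, .refl⟩
    all_goals omega
  | succ k ih =>
    intro b c hc φ ψ hφ hψ h
    obtain rfl : b = !c := by simp [hc]
    rcases h with ⟨n, hn⟩ | ⟨n, hn⟩
    · obtain ⟨m, hm⟩ := plus_succ _ _ _ hψ
      obtain ⟨χ, hχ, hd⟩ := pull _ _ hc _ _ (Cls (!c) k) (rc_cls _ _) (rc_plus _ _)
        (fun φ h1 ψ h2 => ih _ _ (by simp) φ ψ (.inl h1) h2 (.inl h1)) _ _ φ hn ψ hm
      rw [Nat.add_right_comm] at hχ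
      exact ⟨χ, ⟨_, hχ⟩, hd⟩
    · obtain ⟨m, hm⟩ := plus_succ _ _ _ hφ
      obtain ⟨χ, hχ, hd⟩ := pull _ _ hc _ _ (Cls (!c) k) (rc_plus _ _) (rc_cls _ _)
        (fun φ h1 ψ h2 => ih _ _ (by simp) φ ψ h1 (.inl h2) (.inr h2)) _ _ φ hm ψ hn
      exact ⟨χ, ⟨_, hχ⟩, hd⟩

theorem main_R [Infinite V] (k : ℕ) (b : Bool) (φ ψ : Fml L V)
    (hφ : φ ∈ Cls b (k+1)) (hψ : ψ ∈ Cls b (k+1)) :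
    ∃ χ ∈ Cls b (k+2), DTA (.imp φ ψ) χ := by
  obtain ⟨m, hm⟩ := hψ
  obtain ⟨χ, hχ, hd⟩ := pull (!b) b (by simp) _ _ (Cls (!b) (k+1)) (rc_cls b (k+1)) (rc_cls _ _)
    (fun φ h1 ψ h2 => main_EF (k+1) b (!b) rfl φ ψ (.inl h1)
      (.inr ⟨k, by omega, _, h2⟩) (.inl h1)) 0 _ φ hφ ψ hm
  rw [Nat.zero_add] at hχ
  exact ⟨χ, ⟨_, hχ⟩, hd⟩

theorem main_L [Infinite V] (k : ℕ) (b c : Bool) (hc : c = !b) (φ ψ : Fml L V)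
    (hφ : φ ∈ Cls b (k+1)) (hψ : ψ ∈ Cls b (k+1)) :
    ∃ χ ∈ Cls c (k+2), DTA (.imp φ ψ) χ := by
  obtain rfl : b = !c := by simp [hc]
  obtain ⟨n, hn⟩ := hφ
  obtain ⟨χ, hχ, hd⟩ := pull (!c) c hc _ _ (Cls (!c) (k+1)) (rc_cls _ _) (rc_cls (!c) (k+1))
    (fun φ h1 ψ h2 => main_EF (k+1) (!!c) (!c) (by simp) φ ψ (.inr ⟨k, by omega, _, h1⟩)
      (.inl h2) (.inr h2)) _ 0 φ hn ψ hψ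
  exact ⟨χ, ⟨_, hχ⟩, hd⟩

/-- (E) if φ ∈ Σ_{k+1}^+, ψ ∈ Π_{k+1}^+ and k+1 = max{deg φ, deg ψ}, then (φ → ψ) ⊳* some π ∈ Π_{k+1};
(F) if φ ∈ Π_{k+1}^+, ψ ∈ Σ_{k+1}^+ and k+1 = max{deg φ, deg ψ}, then (φ → ψ) ⊳* some σ ∈ Σ_{k+1};
(G) if φ, ψ ∈ Σ_{k+1}, then (φ → ψ) ⊳* some σ ∈ Σ_{k+2} and some π ∈ Π_{k+2};
(H) if φ, ψ ∈ Π_{k+1}, then (φ → ψ) ⊳* some σ ∈ Σ_{k+2} and some π ∈ Π_{k+2}. -/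
theorem stmt14 {L : Lang} {V : Type} [DecidableEq V] [Infinite V] (k : ℕ) :
    (∀ φ ψ : Fml L V, φ ∈ SigmaP (k+1) → ψ ∈ PiP (k+1) →
      k + 1 = max φ.deg ψ.deg → ∃ π ∈ PiC (k+1), DTA (Fml.imp φ ψ) π) ∧
    (∀ φ ψ : Fml L V, φ ∈ PiP (k+1) → ψ ∈ SigmaP (k+1) →
      k + 1 = max φ.deg ψ.deg → ∃ σ ∈ SigmaC (k+1), DTA (Fml.imp φ ψ) σ) ∧
    (∀ φ ψ : Fml L V, φ ∈ SigmaC (k+1) → ψ ∈ SigmaC (k+1) →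
      (∃ σ ∈ SigmaC (k+2), DTA (Fml.imp φ ψ) σ) ∧ (∃ π ∈ PiC (k+2), DTA (Fml.imp φ ψ) π)) ∧
    (∀ φ ψ : Fml L V, φ ∈ PiC (k+1) → ψ ∈ PiC (k+1) →
      (∃ σ ∈ SigmaC (k+2), DTA (Fml.imp φ ψ) σ) ∧ (∃ π ∈ PiC (k+2), DTA (Fml.imp φ ψ) π)) := by
  have key : ∀ (b c : Bool), c = !b → ∀ φ ψ : Fml L V, φ ∈ Plus b (k+1) → ψ ∈ Plus c (k+1) →
      k + 1 = max φ.deg ψ.deg → ∃ χ ∈ Cls c (k+1), DTA (Fml.imp φ ψ) χ := by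
    intro b c hc φ ψ h1 h2 hd
    refine main_EF (k+1) b c hc φ ψ h1 h2 ?_
    rcases le_total φ.deg ψ.deg with h | h
    · exact .inr (cls_of_deg _ _ _ h2 (by rw [hd, max_eq_right h]))
    · exact .inl (cls_of_deg _ _ _ h1 (by rw [hd, max_eq_left h]))
  simp only [sigmaC_eq, piC_eq, sigmaP_eq, piP_eq]
  exact ⟨key true false rfl, key false true rfl,
    fun φ ψ h1 h2 => ⟨main_R k _ φ ψ h1 h2, main_L k _ _ rfl φ ψ h1 h2⟩,
    fun φ ψ h1 h2 => ⟨main_L k _ _ rfl φ ψ h1 h2, main_R k _ φ ψ h1 h2⟩⟩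

end PrenexPaper
end

section
/- For every natural number k and every formula φ: (1) if PNF(φ) ∩ Σ_k^+ ≠ ∅, then φ ∈ E_k^+; (2) if PNF(φ) ∩ Π_k^+ ≠ ∅, then φ ∈ U_k^+. -/
namespace PrenexPaper

variable {L : Lang} {V : Type}

/-! ### Prenex transformations -/

variable [DecidableEq V]

/-- The least `k` such that the formula lies in `E_k^+` (`b = true`) or `U_k^+` (`b = false`). -/
def rk {L : Lang} {V : Type} : Fml L V → Bool → ℕ
  | .falsum, _ => 0
  | .rel _ _, _ => 0
  | .and φ ψ, b => max (rk φ b) (rk ψ b)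
  | .or φ ψ, b => max (rk φ b) (rk ψ b)
  | .imp φ ψ, b => max (rk φ (!b)) (rk ψ b)
  | .all _ φ, b => max 1 (rk φ false) + (if b then 1 else 0)
  | .ex _ φ, b => max 1 (rk φ true) + (if b then 0 else 1)

/-- The cost of a path relative to an initial symbol. -/
def pcost (b : Bool) (s : List Bool) : ℕ :=
  match s with
  | [] => 0
  | c :: t => t.length + 1 + (if c = b then 0 else 1)

theorem pcost_neg (b : Bool) (s : List Bool) : pcost b (negPath s) = pcost (!b) s := by
  cases s with
  | nil => rfl
  | cons c t => cases b <;> cases c <;> simp [pcost, negPath]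

theorem pcost_le_rk {L : Lang} {V : Type} (φ : Fml L V) :
    ∀ b, ∀ s ∈ φ.alt, pcost b s ≤ rk φ b := by
  induction φ with
  | falsum => intro b s hs; simp [Fml.alt] at hs; subst hs; simp [pcost]
  | rel r ts => intro b s hs; simp [Fml.alt] at hs; subst hs; simp [pcost]
  | and φ ψ h1 h2 =>
    intro b s hs
    rcases hs with hs | hs
    · exact (h1 b s hs).trans (le_max_left _ _)
    · exact (h2 b s hs).trans (le_max_right _ _)
  | or φ ψ h1 h2 =>
    intro b s hs
    rcases hs with hs | hs
    · exact (h1 b s hs).trans (le_max_left _ _)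
    · exact (h2 b s hs).trans (le_max_right _ _)
  | imp φ ψ h1 h2 =>
    intro b s hs
    rcases hs with ⟨t, ht, rfl⟩ | hs
    · rw [pcost_neg]
      exact (h1 (!b) t ht).trans (le_max_left _ _)
    · exact (h2 b s hs).trans (le_max_right _ _)
  | all x φ h =>
    intro b s hs
    rcases hs with ⟨hs, hh⟩ | ⟨t, ⟨ht, hh⟩, rfl⟩
    · have := h false s hs
      cases s with
      | nil => simp [pcost]
      | cons c t => cases b <;> cases c <;> simp_all [pcost, rk]
    · have := h false t ht
      cases t with
      | nil => cases b <;> simp_all [pcost, rk]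
      | cons c t => cases b <;> cases c <;> simp_all [pcost, rk]
  | ex x φ h =>
    intro b s hs
    rcases hs with ⟨hs, hh⟩ | ⟨t, ⟨ht, hh⟩, rfl⟩
    · have := h true s hs
      cases s with
      | nil => simp [pcost]
      | cons c t => cases b <;> cases c <;> simp_all [pcost, rk]
    · have := h true t ht
      cases t with
      | nil => cases b <;> simp_all [pcost, rk]
      | cons c t => cases b <;> cases c <;> simp_all [pcost, rk]

theorem rk_flip {L : Lang} {V : Type} (φ : Fml L V) : ∀ b, rk φ b ≤ rk φ (!b) + 1 := by
  induction φ with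
  | falsum => intro b; simp [rk]
  | rel r ts => intro b; simp [rk]
  | and φ ψ h1 h2 => intro b; have := h1 b; have := h2 b; simp only [rk]; omega
  | or φ ψ h1 h2 => intro b; have := h1 b; have := h2 b; simp only [rk]; omega
  | imp φ ψ h1 h2 => intro b; have := h1 (!b); have := h2 b; simp only [rk]; omega
  | all x φ h => intro b; cases b <;> simp only [rk] <;> simp <;> omega
  | ex x φ h => intro b; cases b <;> simp only [rk] <;> simp <;> omega

theorem rk_rename {L : Lang} {V : Type} [DecidableEq V] (x y : V) (φ : Fml L V) :
    ∀ b, rk (φ.rename x y) b = rk φ b := by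
  induction φ with
  | falsum => intro b; rfl
  | rel r ts => intro b; rfl
  | and φ ψ h1 h2 => intro b; simp [Fml.rename, rk, h1, h2]
  | or φ ψ h1 h2 => intro b; simp [Fml.rename, rk, h1, h2]
  | imp φ ψ h1 h2 => intro b; simp [Fml.rename, rk, h1, h2]
  | all z φ h => intro b; by_cases hz : z = x <;> simp [Fml.rename, rk, h, hz]
  | ex z φ h => intro b; by_cases hz : z = x <;> simp [Fml.rename, rk, h, hz]

theorem rk_step {L : Lang} {V : Type} [DecidableEq V] {φ ψ : Fml L V} (h : Step φ ψ) (b : Bool) :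
    rk φ b ≤ rk ψ b := by
  cases h with
  | r8all x y ξ h => simp [rk, rk_rename]
  | r8ex x y ξ h => simp [rk, rk_rename]
  | _ x ξ δ h =>
    have h1 := rk_flip δ true
    have h2 := rk_flip δ false
    cases b <;> simp [rk] at * <;> omega

theorem rk_repl {L : Lang} {V : Type} [DecidableEq V] {φ ψ : Fml L V} (h : Repl Step φ ψ) :
    ∀ b, rk φ b ≤ rk ψ b := by
  induction h with
  | base h => exact rk_step h
  | andL _ ih => intro b; have := ih b; simp only [rk]; omega
  | andR _ ih => intro b; have := ih b; simp only [rk]; omega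
  | orL _ ih => intro b; have := ih b; simp only [rk]; omega
  | orR _ ih => intro b; have := ih b; simp only [rk]; omega
  | impL _ ih => intro b; have := ih (!b); simp only [rk]; omega
  | impR _ ih => intro b; have := ih b; simp only [rk]; omega
  | allC _ ih => intro b; have := ih false; simp only [rk]; omega
  | exC _ ih => intro b; have := ih true; simp only [rk]; omega

theorem rk_dta {L : Lang} {V : Type} [DecidableEq V] {φ ψ : Fml L V} (h : DTA φ ψ) (b : Bool) :
    rk φ b ≤ rk ψ b := by
  induction h with
  | refl => exact le_rfl
  | tail _ h ih => exact ih.trans (rk_repl h b)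

theorem rk_qf {L : Lang} {V : Type} (φ : Fml L V) : φ.qf → ∀ b, rk φ b = 0 := by
  induction φ with
  | falsum => intro _ b; rfl
  | rel r ts => intro _ b; rfl
  | and φ ψ h1 h2 => intro h b; simp [rk, h1 h.1, h2 h.2]
  | or φ ψ h1 h2 => intro h b; simp [rk, h1 h.1, h2 h.2]
  | imp φ ψ h1 h2 => intro h b; simp [rk, h1 h.1, h2 h.2]
  | all z φ h => intro h; exact h.elim
  | ex z φ h => intro h; exact h.elim

theorem rk_SP {L : Lang} {V : Type} (k : ℕ) :
    (∀ φ : Fml L V, φ ∈ SigmaC k → rk φ true ≤ k) ∧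
    (∀ φ : Fml L V, φ ∈ PiC k → rk φ false ≤ k) := by
  induction k with
  | zero => exact ⟨fun φ h => (rk_qf φ h _).le, fun φ h => (rk_qf φ h _).le⟩
  | succ k ih =>
    constructor
    · intro φ h
      replace h : ExBlock (PiC k) φ := h
      induction h with
      | @one x φ h =>
        have := ih.2 φ h
        have := rk_flip φ true
        simp [rk] at *; omega
      | more _ ih => simp [rk] at *; omega
    · intro φ h
      replace h : AllBlock (SigmaC k) φ := h
      induction h with
      | @one x φ h =>
        have := ih.1 φ h
        have := rk_flip φ false
        simp [rk] at *; omega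
      | more _ ih => simp [rk] at *; omega

theorem rk_SigmaP {L : Lang} {V : Type} {k : ℕ} {φ : Fml L V} (h : φ ∈ SigmaP k) :
    rk φ true ≤ k := by
  rcases h with h | h
  · exact (rk_SP k).1 φ h
  · simp only [Set.mem_iUnion] at h
    obtain ⟨i, hi, h | h⟩ := h
    · have := (rk_SP i).1 φ h
      omega
    · have := (rk_SP i).2 φ h
      have := rk_flip φ true
      simp at this
      omega

theorem rk_PiP {L : Lang} {V : Type} {k : ℕ} {φ : Fml L V} (h : φ ∈ PiP k) :
    rk φ false ≤ k := by
  rcases h with h | h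
  · exact (rk_SP k).2 φ h
  · simp only [Set.mem_iUnion] at h
    obtain ⟨i, hi, h | h⟩ := h
    · have := (rk_SP i).1 φ h
      have := rk_flip φ false
      simp at this
      omega
    · have := (rk_SP i).2 φ h
      omega

theorem length_le_pcost (b : Bool) (s : List Bool) : s.length ≤ pcost b s := by
  cases s <;> simp [pcost]

theorem deg_le_rk {L : Lang} {V : Type} (φ : Fml L V) (b : Bool) : φ.deg ≤ rk φ b := by
  apply csSup_le'
  rintro _ ⟨s, hs, rfl⟩
  exact (length_le_pcost b s).trans (pcost_le_rk φ b s hs)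

theorem head_of_rk {L : Lang} {V : Type} {φ : Fml L V} {b : Bool} {k : ℕ} (h : rk φ b ≤ k + 1) :
    ∀ s ∈ φ.alt, s.length = k + 1 → s.head? = some b := by
  intro s hs hl
  have h1 := (pcost_le_rk φ b s hs).trans h
  cases s with
  | nil => simp at hl
  | cons c t =>
    by_cases hc : c = b
    · simp [hc]
    · simp [pcost, hc] at h1 hl
      omega

theorem mem_EcP {L : Lang} {V : Type} {φ : Fml L V} {k : ℕ} (h : rk φ true ≤ k) : φ ∈ EcP k := by
  rcases ((deg_le_rk φ true).trans h).lt_or_eq with hd | hd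
  · right
    simp only [Set.mem_iUnion]
    exact ⟨_, hd, rfl⟩
  · left
    cases k with
    | zero => exact hd
    | succ k => exact ⟨hd, head_of_rk h⟩

theorem mem_UcP {L : Lang} {V : Type} {φ : Fml L V} {k : ℕ} (h : rk φ false ≤ k) : φ ∈ UcP k := by
  rcases ((deg_le_rk φ false).trans h).lt_or_eq with hd | hd
  · right
    simp only [Set.mem_iUnion]
    exact ⟨_, hd, rfl⟩
  · left
    cases k with
    | zero => exact hd
    | succ k => exact ⟨hd, head_of_rk h⟩

/-- (1) if PNF(φ) ∩ Σ_k^+ ≠ ∅, then φ ∈ E_k^+;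
(2) if PNF(φ) ∩ Π_k^+ ≠ ∅, then φ ∈ U_k^+. -/
theorem stmt18 {L : Lang} {V : Type} [DecidableEq V] (k : ℕ) (φ : Fml L V) :
    (PNF φ ∩ SigmaP k ≠ ∅ → φ ∈ EcP k) ∧
    (PNF φ ∩ PiP k ≠ ∅ → φ ∈ UcP k) := by
  constructor
  · intro h
    obtain ⟨ψ, ⟨hd, _⟩, hs⟩ := Set.nonempty_iff_ne_empty.mpr h
    exact mem_EcP ((rk_dta hd true).trans (rk_SigmaP hs))
  · intro h
    obtain ⟨ψ, ⟨hd, _⟩, hs⟩ := Set.nonempty_iff_ne_empty.mpr h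
    exact mem_UcP ((rk_dta hd false).trans (rk_PiP hs))

end PrenexPaper
end
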